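/- Let H be a linearly ordered group with strong unit u > 0 and let M = Γ(K,v) be a weakly (H,u)-perfect pseudo MV-algebra. Then there exist a (not necessarily abelian) ℓ-group G and an element b ∈ G⁺ such that M is isomorphic, as a pseudo MV-algebra, to Γ(H ×lex G, (u,b)). -/

import Mathlib

universe uK

/-- `v` is a strong (order) unit of an ordered group: `v ≥ 0` and every element is
dominated by some positive multiple of `v`. -/
def IsStrongOrderUnit {G : Type*} [AddMonoid G] [PartialOrder G] (v : G) : Prop :=
  0 ≤ v ∧ ∀ g : G, ∃ n : ℕ, 0 < n ∧ g ≤ n • v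

section LexDefs

variable {H G : Type*}

/-- The lexicographic order on the product `H × G`:
`(h,g) ≤ (h',g')` iff `h < h'` or (`h = h'` and `g ≤ g'`). -/
def lexLe [LT H] [LE G] (p q : H × G) : Prop :=
  p.1 < q.1 ∨ (p.1 = q.1 ∧ p.2 ≤ q.2)

/-- The meet in the lexicographic product of a linear order with a lattice. -/
def lexInf [LinearOrder H] [Lattice G] (p q : H × G) : H × G :=
  if p.1 < q.1 then p else if q.1 < p.1 then q else (p.1, p.2 ⊓ q.2)

end LexDefs

section Decomposition

variable {H : Type*} [AddGroup H] [LinearOrder H]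
  [CovariantClass H H (· + ·) (· ≤ ·)]
  [CovariantClass H H (Function.swap (· + ·)) (· ≤ ·)]
variable {K : Type uK} [AddGroup K] [Lattice K]
  [CovariantClass K K (· + ·) (· ≤ ·)]
  [CovariantClass K K (Function.swap (· + ·)) (· ≤ ·)]

/-- An `(H,u)`-decomposition of the pseudo MV-algebra `M = Γ(K,v)`. -/
structure IsHuDecomposition (u : H) (v : K) (Mt : H → Set K) : Prop where
  nonempty : ∀ t ∈ Set.Icc (0 : H) u, (Mt t).Nonempty
  subset_carrier : ∀ t ∈ Set.Icc (0 : H) u, Mt t ⊆ Set.Icc (0 : K) v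
  pairwise_disjoint : ∀ s ∈ Set.Icc (0 : H) u, ∀ t ∈ Set.Icc (0 : H) u,
    s ≠ t → Disjoint (Mt s) (Mt t)
  cover : ∀ x ∈ Set.Icc (0 : K) v, ∃ t ∈ Set.Icc (0 : H) u, x ∈ Mt t
  le_of_lt : ∀ s ∈ Set.Icc (0 : H) u, ∀ t ∈ Set.Icc (0 : H) u, s < t →
    ∀ a ∈ Mt s, ∀ b ∈ Mt t, a ≤ b
  compl_image : ∀ t ∈ Set.Icc (0 : H) u, (fun x => v - x) '' Mt t = Mt (u - t)
  sim_image : ∀ t ∈ Set.Icc (0 : H) u, (fun x => -x + v) '' Mt t = Mt (-t + u)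
  oplus_mem : ∀ s ∈ Set.Icc (0 : H) u, ∀ t ∈ Set.Icc (0 : H) u,
    ∀ x ∈ Mt s, ∀ y ∈ Mt t, (x + y) ⊓ v ∈ Mt (min (s + t) u)

namespace IsHuDecomposition

variable {u : H} {v : K} {Mt : H → Set K}

lemma index_unique (h : IsHuDecomposition u v Mt) {s t : H} (hs : s ∈ Set.Icc 0 u)
    (ht : t ∈ Set.Icc 0 u) {x : K} (hxs : x ∈ Mt s) (hxt : x ∈ Mt t) : s = t := by
  by_contra hne
  exact Set.disjoint_left.mp (h.pairwise_disjoint s hs t ht hne) hxs hxt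

lemma index_mono (h : IsHuDecomposition u v Mt) {s t : H} (hs : s ∈ Set.Icc 0 u)
    (ht : t ∈ Set.Icc 0 u) {x y : K} (hx : x ∈ Mt s) (hy : y ∈ Mt t) (hxy : x ≤ y) :
    s ≤ t := by
  by_contra! hlt
  obtain rfl := le_antisymm hxy (h.le_of_lt t ht s hs hlt y hy x hx)
  exact hlt.ne (h.index_unique ht hs hy hx)

lemma zero_mem (h : IsHuDecomposition u v Mt) (hu : 0 ≤ u) (hv : 0 ≤ v) : (0 : K) ∈ Mt 0 := by
  have h0 : (0 : H) ∈ Set.Icc 0 u := ⟨le_rfl, hu⟩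
  obtain ⟨t, ht, h0t⟩ := h.cover 0 ⟨le_rfl, hv⟩
  rcases ht.1.eq_or_lt with rfl | hlt
  · exact h0t
  · obtain ⟨a, ha⟩ := h.nonempty 0 h0
    rwa [le_antisymm (h.subset_carrier 0 h0 ha).1 (h.le_of_lt 0 h0 t ht hlt a ha 0 h0t)]

lemma sub_index_mem {t : H} (ht : t ∈ Set.Icc 0 u) : u - t ∈ Set.Icc 0 u :=
  ⟨sub_nonneg.mpr ht.2, sub_le_self_iff u |>.mpr ht.1⟩

lemma neg_add_index_mem {t : H} (ht : t ∈ Set.Icc 0 u) : -t + u ∈ Set.Icc 0 u :=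
  ⟨by rw [le_neg_add_iff_add_le, add_zero]; exact ht.2,
    add_le_of_nonpos_left (neg_nonpos.mpr ht.1)⟩

lemma sub_mem (h : IsHuDecomposition u v Mt) {t : H} (ht : t ∈ Set.Icc 0 u) {x : K}
    (hx : x ∈ Mt t) : v - x ∈ Mt (u - t) := by
  rw [← h.compl_image t ht]
  exact ⟨x, hx, rfl⟩

lemma neg_add_mem (h : IsHuDecomposition u v Mt) {t : H} (ht : t ∈ Set.Icc 0 u) {x : K}
    (hx : x ∈ Mt t) : -x + v ∈ Mt (-t + u) := by
  rw [← h.sim_image t ht]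
  exact ⟨x, hx, rfl⟩

lemma unit_mem (h : IsHuDecomposition u v Mt) (hu : 0 ≤ u) (hv : 0 ≤ v) : v ∈ Mt u := by
  simpa using h.sub_mem ⟨le_rfl, hu⟩ (h.zero_mem hu hv)

lemma add_le_of_lt (h : IsHuDecomposition u v Mt) {s t : H} (hs : s ∈ Set.Icc 0 u)
    (ht : t ∈ Set.Icc 0 u) {x y : K} (hx : x ∈ Mt s) (hy : y ∈ Mt t) (hst : s + t < u) :
    x + y ≤ v :=
  le_sub_iff_add_le.mp <| h.le_of_lt s hs _ (sub_index_mem ht) (lt_sub_iff_add_lt.mpr hst) x hx _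
    (h.sub_mem ht hy)

lemma le_add_of_lt (h : IsHuDecomposition u v Mt) {s t : H} (hs : s ∈ Set.Icc 0 u)
    (ht : t ∈ Set.Icc 0 u) {x y : K} (hx : x ∈ Mt s) (hy : y ∈ Mt t) (hst : u < s + t) :
    v ≤ x + y :=
  sub_le_iff_le_add.mp <| h.le_of_lt _ (sub_index_mem ht) s hs (sub_lt_iff_lt_add.mpr hst) _
    (h.sub_mem ht hy) x hx

lemma index_add_le (h : IsHuDecomposition u v Mt) {s t : H} (hs : s ∈ Set.Icc 0 u)
    (ht : t ∈ Set.Icc 0 u) {x y : K} (hx : x ∈ Mt s) (hy : y ∈ Mt t) (hxy : x + y ≤ v) :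
    s + t ≤ u :=
  le_sub_iff_add_le.mp <| h.index_mono hs (sub_index_mem ht) hx (h.sub_mem ht hy)
    (le_sub_iff_add_le.mpr hxy)

lemma add_mem (h : IsHuDecomposition u v Mt) {s t : H} (hs : s ∈ Set.Icc 0 u)
    (ht : t ∈ Set.Icc 0 u) {x y : K} (hx : x ∈ Mt s) (hy : y ∈ Mt t) (hxy : x + y ≤ v) :
    x + y ∈ Mt (s + t) := by
  have := h.oplus_mem s hs t ht x hx y hy
  rwa [inf_eq_left.mpr hxy, min_eq_left (h.index_add_le hs ht hx hy hxy)] at this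

/-- If `x + y = z` inside `[0,v]` with `x ∈ M_s`, `y ∈ M_t` and `z ∈ M_r`, then `s + t = r`. -/
lemma index_add_eq (h : IsHuDecomposition u v Mt) {s t r : H} (hs : s ∈ Set.Icc 0 u)
    (ht : t ∈ Set.Icc 0 u) (hr : r ∈ Set.Icc 0 u) {x y : K} (hx : x ∈ Mt s) (hy : y ∈ Mt t)
    (hxy : x + y ∈ Mt r) : s + t = r := by
  have hle := (h.subset_carrier r hr hxy).2
  exact h.index_unique ⟨add_nonneg hs.1 ht.1, h.index_add_le hs ht hx hy hle⟩ hr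
    (h.add_mem hs ht hx hy hle) hxy

lemma zero_convex (h : IsHuDecomposition u v Mt) (hu : 0 ≤ u) {x y : K} (hx : 0 ≤ x)
    (hxy : x ≤ y) (hy : y ∈ Mt 0) : x ∈ Mt 0 := by
  have h0 : (0 : H) ∈ Set.Icc 0 u := ⟨le_rfl, hu⟩
  obtain ⟨t, ht, hxt⟩ := h.cover x ⟨hx, hxy.trans (h.subset_carrier 0 h0 hy).2⟩
  rwa [le_antisymm (h.index_mono ht h0 hxt hy hxy) ht.1] at hxt

lemma zero_add_mem (h : IsHuDecomposition u v Mt) (hu : 0 < u) {x y : K} (hx : x ∈ Mt 0)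
    (hy : y ∈ Mt 0) : x + y ∈ Mt 0 := by
  have h0 : (0 : H) ∈ Set.Icc 0 u := ⟨le_rfl, hu.le⟩
  have := h.add_mem h0 h0 hx hy (h.add_le_of_lt h0 h0 hx hy (by simpa using hu))
  rwa [add_zero] at this

lemma inf_add_self_le {a b : K} (ha : 0 ≤ a) (hb : 0 ≤ b) :
    a ⊓ (b + b) ≤ a ⊓ b + a ⊓ b := by
  rw [add_inf, inf_add, inf_add]
  refine le_inf (le_inf ?_ ?_) (le_inf ?_ inf_le_right)
  · exact inf_le_left.trans (le_add_of_nonneg_left ha)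
  · exact inf_le_left.trans (le_add_of_nonneg_left hb)
  · exact inf_le_left.trans (le_add_of_nonneg_right hb)

lemma sup_le_add {a b : K} (ha : 0 ≤ a) (hb : 0 ≤ b) : a ⊔ b ≤ a + b :=
  sup_le (le_add_of_nonneg_right hb) (le_add_of_nonneg_left ha)

/-- If `d, e ∈ M_r` are disjoint and `r > 0`, then `d ⊓ c ∈ M_r` for every `c ∈ M_r` with
`c + c ≤ v`. -/
lemma inf_mem_of_disjoint (h : IsHuDecomposition u v Mt) (hu : 0 < u) {r : H}
    (hr : r ∈ Set.Icc 0 u) {c d e : K} (hc : c ∈ Mt r) (hcv : c + c ≤ v) (hd : d ∈ Mt r)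
    (he : e ∈ Mt r) (hde : d ⊓ e = 0) (hr0 : 0 < r) : d ⊓ c ∈ Mt r := by
  have h0 : (0 : H) ∈ Set.Icc 0 u := ⟨le_rfl, hu.le⟩
  obtain ⟨hc0, -⟩ := h.subset_carrier r hr hc
  obtain ⟨hd0, hdv⟩ := h.subset_carrier r hr hd
  have hv : 0 ≤ v := hd0.trans hdv
  obtain ⟨i, hi, hmi⟩ := h.cover (d ⊓ c) ⟨le_inf hd0 hc0, inf_le_left.trans hdv⟩
  rcases (h.index_mono hi hr hmi hd inf_le_left).eq_or_lt with rfl | hir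
  · exact hmi
  have hm0 : d ⊓ c = 0 := le_antisymm
    (hde ▸ le_inf inf_le_left (h.le_of_lt i hi r hr hir _ hmi e he)) (le_inf hd0 hc0)
  have hd2 : d ≤ c + c :=
    h.le_of_lt r hr (r + r) ⟨add_nonneg hr.1 hr.1, h.index_add_le hr hr hc hc hcv⟩
      (lt_add_of_pos_left r hr0) d hd _ (h.add_mem hr hr hc hc hcv)
  have hd_zero : d ≤ 0 := by
    have := inf_add_self_le hd0 hc0
    rwa [inf_eq_left.mpr hd2, hm0, add_zero] at this
  exact absurd (h.index_mono hr h0 hd (h.zero_mem hu.le hv) hd_zero) hr0.not_ge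

/-- Disjoint elements lying in the same slice lie in the bottom slice. -/
lemma index_eq_zero_of_disjoint (h : IsHuDecomposition u v Mt) (hu : 0 < u) {r : H}
    (hr : r ∈ Set.Icc 0 u) (hhalf : r + r ≤ u → ∃ c ∈ Mt r, c + c ≤ v) {d e : K}
    (hd : d ∈ Mt r) (he : e ∈ Mt r) (hde : d ⊓ e = 0) : r = 0 := by
  have h0 : (0 : H) ∈ Set.Icc 0 u := ⟨le_rfl, hu.le⟩
  by_contra hr_ne
  have hr0 : 0 < r := lt_of_le_of_ne hr.1 (Ne.symm hr_ne)
  obtain ⟨hd0, hdv⟩ := h.subset_carrier r hr hd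
  have hv : 0 ≤ v := hd0.trans hdv
  rcases le_or_gt (r + r) u with hru | hru
  · obtain ⟨c, hc, hcv⟩ := hhalf hru
    have hdc := h.inf_mem_of_disjoint hu hr hc hcv hd he hde hr0
    have hec := h.inf_mem_of_disjoint hu hr hc hcv he hd (inf_comm d e ▸ hde) hr0
    have key : ∀ a ∈ Mt r, a ≤ c → c - a ∈ Mt 0 := by
      intro a ha hac
      obtain ⟨q, hq, hcq⟩ := h.cover (c - a) ⟨sub_nonneg.mpr hac,
        (sub_le_self_iff c |>.mpr (h.subset_carrier r hr ha).1).trans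
          (h.subset_carrier r hr hc).2⟩
      have := h.index_add_eq hq hr hr hcq ha (by rwa [sub_add_cancel])
      rwa [add_eq_right.mp this] at hcq
    have hf := key _ hdc inf_le_right
    have hg := key _ hec inf_le_right
    have hcfg : c = (c - d ⊓ c) ⊔ (c - e ⊓ c) := by
      have h1 : (d ⊓ c) ⊓ (e ⊓ c) = 0 :=
        le_antisymm (hde ▸ inf_le_inf inf_le_left inf_le_left)
          (le_inf (h.subset_carrier r hr hdc).1 (h.subset_carrier r hr hec).1)
      rw [sub_eq_add_neg, sub_eq_add_neg, ← add_sup, ← neg_inf, h1, neg_zero, add_zero]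
    have hle : c ≤ (c - d ⊓ c) + (c - e ⊓ c) :=
      hcfg.le.trans (sup_le_add (h.subset_carrier 0 h0 hf).1 (h.subset_carrier 0 h0 hg).1)
    exact hr0.not_ge (h.index_mono hr h0 hc (h.zero_add_mem hu hf hg) hle)
  · have hlt : u - r < r := sub_lt_iff_lt_add.mpr hru
    have h1 := h.le_of_lt _ (sub_index_mem hr) r hr hlt _ (h.sub_mem hr hd) d hd
    have h2 := h.le_of_lt _ (sub_index_mem hr) r hr hlt _ (h.sub_mem hr hd) e he
    have hvd : v = d := le_antisymm (sub_nonpos.mp (hde ▸ le_inf h1 h2)) hdv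
    have h3 := h.le_of_lt _ (sub_index_mem hr) r hr hlt _ (h.sub_mem hr he) d hd
    have h4 := h.le_of_lt _ (sub_index_mem hr) r hr hlt _ (h.sub_mem hr he) e he
    have hve : v ≤ e := sub_nonpos.mp (hde ▸ le_inf h3 h4)
    have hv0 : v ≤ 0 := hde ▸ le_inf hvd.le hve
    exact hr0.not_ge (h.index_mono hr h0 hd (h.zero_mem hu.le hv) (hdv.trans hv0))

/-- The two one-sided differences of elements of the same slice lie in the bottom slice. -/
lemma sub_inf_mem (h : IsHuDecomposition u v Mt) (hu : 0 < u)
    (hhalf : ∀ r ∈ Set.Icc (0 : H) u, r + r ≤ u → ∃ c ∈ Mt r, c + c ≤ v) {t : H}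
    (ht : t ∈ Set.Icc 0 u) {x y : K} (hx : x ∈ Mt t) (hy : y ∈ Mt t) :
    x - x ⊓ y ∈ Mt 0 ∧ y - x ⊓ y ∈ Mt 0 := by
  have h0 : (0 : H) ∈ Set.Icc 0 u := ⟨le_rfl, hu.le⟩
  obtain ⟨hx0, hxv⟩ := h.subset_carrier t ht hx
  obtain ⟨hy0, hyv⟩ := h.subset_carrier t ht hy
  have hxy0 : 0 ≤ x ⊓ y := le_inf hx0 hy0
  have hd0 : 0 ≤ x - x ⊓ y := sub_nonneg.mpr inf_le_left
  have he0 : 0 ≤ y - x ⊓ y := sub_nonneg.mpr inf_le_right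
  have hde : (x - x ⊓ y) ⊓ (y - x ⊓ y) = 0 := by
    rw [sub_eq_add_neg, sub_eq_add_neg, ← inf_add, add_neg_cancel]
  obtain ⟨r, hr, hdr⟩ := h.cover _ ⟨hd0, (sub_le_self_iff x |>.mpr hxy0).trans hxv⟩
  obtain ⟨q, hq, heq⟩ := h.cover _ ⟨he0, (sub_le_self_iff y |>.mpr hxy0).trans hyv⟩
  have hzero := h.zero_mem hu.le (hx0.trans hxv)
  rcases lt_trichotomy r q with hrq | rfl | hqr
  · have hd_zero : x - x ⊓ y = 0 :=
      (inf_eq_left.mpr (h.le_of_lt r hr q hq hrq _ hdr _ heq)).symm.trans hde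
    have hxe : x ⊓ y = x := (sub_eq_zero.mp hd_zero).symm
    have := h.index_add_eq hq ht ht heq hx (by rwa [hxe, sub_add_cancel])
    rw [add_eq_right.mp this] at heq
    exact ⟨hd_zero ▸ hzero, heq⟩
  · obtain rfl := h.index_eq_zero_of_disjoint hu hr (hhalf r hr) hdr heq hde
    exact ⟨hdr, heq⟩
  · have he_zero : y - x ⊓ y = 0 :=
      (inf_eq_right.mpr (h.le_of_lt q hq r hr hqr _ heq _ hdr)).symm.trans hde
    have hye : x ⊓ y = y := (sub_eq_zero.mp he_zero).symm
    have := h.index_add_eq hr ht ht hdr hy (by rwa [hye, sub_add_cancel])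
    rw [add_eq_right.mp this] at hdr
    exact ⟨hdr, he_zero ▸ hzero⟩

/-- The ℓ-subgroup of `K` whose positive cone is `M_0`. -/
def infinitesimals (h : IsHuDecomposition u v Mt) (hu : 0 < u) (hv : 0 ≤ v) : AddSubgroup K where
  carrier := {k | k ⊔ 0 ∈ Mt 0 ∧ -k ⊔ 0 ∈ Mt 0}
  zero_mem' := by simpa using h.zero_mem hu.le hv
  neg_mem' := fun {a} ha => ⟨ha.2, by simpa using ha.1⟩
  add_mem' := fun {a b} ha hb => by
    have key : ∀ {x y : K}, x ⊔ 0 ∈ Mt 0 → y ⊔ 0 ∈ Mt 0 → (x + y) ⊔ 0 ∈ Mt 0 :=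
      fun hx hy => h.zero_convex hu.le le_sup_right
        (sup_le (add_le_add le_sup_left le_sup_left) (add_nonneg le_sup_right le_sup_right))
        (h.zero_add_mem hu hx hy)
    refine ⟨key ha.1 hb.1, ?_⟩
    rw [neg_add_rev]
    exact key hb.2 ha.2

lemma sup_mem_infinitesimals (h : IsHuDecomposition u v Mt) (hu : 0 < u) (hv : 0 ≤ v) {a b : K}
    (ha : a ∈ h.infinitesimals hu hv) (hb : b ∈ h.infinitesimals hu hv) :
    a ⊔ b ∈ h.infinitesimals hu hv := by
  refine ⟨h.zero_convex hu.le le_sup_right (sup_le (sup_le ?_ ?_) ?_)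
    (h.zero_add_mem hu ha.1 hb.1), h.zero_convex hu.le le_sup_right ?_ ha.2⟩
  · exact le_sup_left.trans (le_add_of_nonneg_right le_sup_right)
  · exact le_sup_left.trans (le_add_of_nonneg_left le_sup_right)
  · exact add_nonneg le_sup_right le_sup_right
  · exact sup_le_sup_right (neg_le_neg_iff.mpr le_sup_left) 0

lemma inf_mem_infinitesimals (h : IsHuDecomposition u v Mt) (hu : 0 < u) (hv : 0 ≤ v) {a b : K}
    (ha : a ∈ h.infinitesimals hu hv) (hb : b ∈ h.infinitesimals hu hv) :
    a ⊓ b ∈ h.infinitesimals hu hv := by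
  rw [← neg_neg (a ⊓ b), neg_inf]
  exact neg_mem (h.sup_mem_infinitesimals hu hv (neg_mem ha) (neg_mem hb))

lemma sub_mem_infinitesimals (h : IsHuDecomposition u v Mt) (hu : 0 < u) (hv : 0 ≤ v)
    (hhalf : ∀ r ∈ Set.Icc (0 : H) u, r + r ≤ u → ∃ c ∈ Mt r, c + c ≤ v) {t : H}
    (ht : t ∈ Set.Icc 0 u) {x y : K} (hx : x ∈ Mt t) (hy : y ∈ Mt t) :
    x - y ∈ h.infinitesimals hu hv := by
  obtain ⟨h1, h2⟩ := h.sub_inf_mem hu hhalf ht hx hy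
  have key : ∀ a b : K, (a - b) ⊔ 0 = a - a ⊓ b := fun a b => by
    rw [sub_eq_add_neg, sub_eq_add_neg, neg_inf, add_sup, add_neg_cancel, sup_comm]
  refine ⟨(key x y).symm ▸ h1, ?_⟩
  rw [neg_sub, key, inf_comm]
  exact h2

/-- Translating an element of a slice by an infinitesimal stays in the slice, as long as
the bounds of `[0,v]` are respected. -/
lemma infinitesimal_add_mem (h : IsHuDecomposition u v Mt) (hu : 0 < u) (hv : 0 ≤ v) {t : H}
    (ht : t ∈ Set.Icc 0 u) {g c : K} (hg : g ∈ h.infinitesimals hu hv) (hc : c ∈ Mt t)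
    (hlow : t = 0 → 0 ≤ g + c) (hup : t = u → g + c ≤ v) : g + c ∈ Mt t := by
  have h0 : (0 : H) ∈ Set.Icc 0 u := ⟨le_rfl, hu.le⟩
  have h_nonneg : 0 ≤ g + c := by
    rcases ht.1.eq_or_lt with h' | h'
    · exact hlow h'.symm
    · exact neg_le_iff_add_nonneg'.mp (le_sup_left.trans (h.le_of_lt 0 h0 t ht h' _ hg.2 c hc))
  have h_le : (g ⊔ 0) + c ≤ v := by
    rcases ht.2.eq_or_lt with h' | h'
    · rw [sup_add, zero_add]
      exact sup_le (hup h') (h.subset_carrier t ht hc).2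
    · exact h.add_le_of_lt h0 ht hg.1 hc (by rwa [zero_add])
  obtain ⟨s, hs, hgs⟩ := h.cover (g + c)
    ⟨h_nonneg, (add_le_add_left le_sup_left c).trans h_le⟩
  have h_sum : (-g ⊔ 0) + (g + c) = (g ⊔ 0) + c := by
    rw [← add_assoc, sup_add, neg_add_cancel, zero_add, sup_comm]
  have h_mem := h.add_mem h0 ht hg.1 hc h_le
  rw [zero_add, ← h_sum] at h_mem
  have := h.index_add_eq h0 hs ht hg.2 hgs h_mem
  rw [zero_add] at this
  rwa [this] at hgs

end IsHuDecomposition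

/-- Every weakly `(H,u)`-perfect pseudo MV-algebra `M = Γ(K,v)`
(an `(H,u)`-decomposition `(Mt t)` together with elements `c t ∈ Mt t` with
`c (s+t) = c s + c t` for `s + t ≤ u`,
`(x + y) - c (s+t) = (x - c s) + (y - c t)` for `x ∈ Mt s`, `y ∈ Mt t`, `s + t ≤ u`,
and `x - c t = -(c t) + x` for `x ∈ Mt t`) is isomorphic, as a pseudo MV-algebra,
to `Γ(H ×lex G, (u,b))` for some (not necessarily abelian) ℓ-group `G` and some
`b ∈ G⁺`. -/
theorem statement_16 (u : H) (v : K) (hu : 0 < u)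
    (hsuH : IsStrongOrderUnit u) (hsuK : IsStrongOrderUnit v)
    (Mt : H → Set K) (c : H → K)
    (hdec : IsHuDecomposition u v Mt)
    (hc_mem : ∀ t ∈ Set.Icc (0 : H) u, c t ∈ Mt t)
    (hc_add : ∀ s ∈ Set.Icc (0 : H) u, ∀ t ∈ Set.Icc (0 : H) u, s + t ≤ u →
      c (s + t) = c s + c t)
    (hc_lex : ∀ s ∈ Set.Icc (0 : H) u, ∀ t ∈ Set.Icc (0 : H) u, s + t ≤ u →
      ∀ x ∈ Mt s, ∀ y ∈ Mt t, (x + y) - c (s + t) = (x - c s) + (y - c t))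
    (hc_comm : ∀ t ∈ Set.Icc (0 : H) u, ∀ x ∈ Mt t, x - c t = -(c t) + x) :
    ∃ (G : Type uK) (_ : AddGroup G) (_ : Lattice G),
      (∀ a b : G, a ≤ b → ∀ x y : G, x + a + y ≤ x + b + y) ∧
      ∃ b : G, 0 ≤ b ∧
      ∃ φ : K → H × G,
        (∀ x ∈ Set.Icc (0 : K) v, lexLe (0 : H × G) (φ x) ∧ lexLe (φ x) ((u, b) : H × G)) ∧
        (∀ x ∈ Set.Icc (0 : K) v, ∀ y ∈ Set.Icc (0 : K) v, φ x = φ y → x = y) ∧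
        (∀ p : H × G, lexLe 0 p → lexLe p ((u, b) : H × G) →
          ∃ x ∈ Set.Icc (0 : K) v, φ x = p) ∧
        φ 0 = 0 ∧ φ v = ((u, b) : H × G) ∧
        (∀ x ∈ Set.Icc (0 : K) v, ∀ y ∈ Set.Icc (0 : K) v,
          φ ((x + y) ⊓ v) = lexInf (φ x + φ y) ((u, b) : H × G)) ∧
        (∀ x ∈ Set.Icc (0 : K) v, φ (v - x) = ((u, b) : H × G) - φ x) ∧
        (∀ x ∈ Set.Icc (0 : K) v, φ (-x + v) = -(φ x) + ((u, b) : H × G)) := by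
  have hv := hsuK.1
  have h0 : (0 : H) ∈ Set.Icc 0 u := ⟨le_rfl, hu.le⟩
  have hu' : u ∈ Set.Icc 0 u := ⟨hu.le, le_rfl⟩
  have hc0 : c 0 = 0 := by
    have := hc_add 0 h0 0 h0 (by simpa using hu.le)
    rw [add_zero] at this
    exact left_eq_add.mp this
  have hhalf : ∀ r ∈ Set.Icc (0 : H) u, r + r ≤ u → ∃ c ∈ Mt r, c + c ≤ v := by
    intro r hr hru
    have hrr : r + r ∈ Set.Icc 0 u := ⟨add_nonneg hr.1 hr.1, hru⟩
    refine ⟨c r, hc_mem r hr, ?_⟩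
    rw [← hc_add r hr r hr hru]
    exact (hdec.subset_carrier _ hrr (hc_mem _ hrr)).2
  let G := hdec.infinitesimals hu hv
  let L : Lattice G := Subtype.lattice (fun _ _ => hdec.sup_mem_infinitesimals hu hv)
    (fun _ _ => hdec.inf_mem_infinitesimals hu hv)
  have hvu : v ∈ Mt u := hdec.unit_mem hu.le hv
  have hG : ∀ t ∈ Set.Icc (0 : H) u, ∀ x ∈ Mt t, x - c t ∈ G := fun t ht x hx =>
    hdec.sub_mem_infinitesimals hu hv hhalf ht hx (hc_mem t ht)
  have hex : ∀ x : K, ∃ p : H × G,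
      ∀ t ∈ Set.Icc (0 : H) u, x ∈ Mt t → p.1 = t ∧ (p.2 : K) = x - c t := by
    intro x
    by_cases hx : x ∈ Set.Icc 0 v
    · obtain ⟨t, ht, hxt⟩ := hdec.cover x hx
      refine ⟨(t, ⟨x - c t, hG t ht x hxt⟩), fun s hs hxs => ?_⟩
      obtain rfl := hdec.index_unique ht hs hxt hxs
      exact ⟨rfl, rfl⟩
    · exact ⟨0, fun t ht hxt => absurd (hdec.subset_carrier t ht hxt) hx⟩
  choose φ hφ using hex
  have hφ_eq : ∀ t ∈ Set.Icc (0 : H) u, ∀ x ∈ Mt t, ∀ p : H × G, p.1 = t →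
      (p.2 : K) = x - c t → φ x = p := fun t ht x hx p h1 h2 =>
    Prod.ext ((hφ x t ht hx).1.trans h1.symm) (Subtype.ext ((hφ x t ht hx).2.trans h2.symm))
  refine ⟨G, inferInstance, L, fun a b hab x y => ?_, ⟨v - c u, hG u hu' v hvu⟩, ?_, φ,
    ?_, ?_, ?_, ?_, ?_, ?_, ?_, ?_⟩
  · exact add_le_add_left (add_le_add_right (show (a : K) ≤ b from hab) (x : K)) (y : K)
  · exact sub_nonneg.mpr (hdec.subset_carrier u hu' (hc_mem u hu')).2
  · intro x hx
    obtain ⟨t, ht, hxt⟩ := hdec.cover x hx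
    obtain ⟨h1, h2⟩ := hφ x t ht hxt
    constructor
    · rcases ht.1.eq_or_lt with rfl | hlt
      · refine Or.inr ⟨h1.symm, ?_⟩
        change (0 : K) ≤ ((φ x).2 : K)
        rw [h2, hc0, sub_zero]
        exact hx.1
      · exact Or.inl (hlt.trans_eq h1.symm)
    · rcases ht.2.eq_or_lt with rfl | hlt
      · refine Or.inr ⟨h1, ?_⟩
        change ((φ x).2 : K) ≤ v - c t
        rw [h2]
        exact sub_le_sub_right hx.2 _
      · exact Or.inl (h1.trans_lt hlt)
  · intro x hx y hy hxy
    obtain ⟨s, hs, hxs⟩ := hdec.cover x hx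
    obtain ⟨t, ht, hyt⟩ := hdec.cover y hy
    obtain ⟨h1, h2⟩ := hφ x s hs hxs
    obtain ⟨h3, h4⟩ := hφ y t ht hyt
    rw [hxy] at h1 h2
    obtain rfl := h1.symm.trans h3
    exact sub_left_injective (h2.symm.trans h4)
  · rintro ⟨t, g⟩ hlow hup
    have ht : t ∈ Set.Icc 0 u :=
      ⟨hlow.elim le_of_lt fun h => h.1.le, hup.elim le_of_lt fun h => h.1.le⟩
    have hmem : (g : K) + c t ∈ Mt t := by
      refine hdec.infinitesimal_add_mem hu hv ht g.2 (hc_mem t ht) ?_ ?_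
      · rintro rfl
        rcases hlow with h | h
        · exact absurd h (lt_irrefl 0)
        · rw [hc0, add_zero]
          exact h.2
      · rintro rfl
        rcases hup with h | h
        · exact absurd h (lt_irrefl t)
        · exact le_sub_iff_add_le.mp h.2
    exact ⟨_, hdec.subset_carrier t ht hmem,
      hφ_eq t ht _ hmem _ rfl (add_sub_cancel_right _ _).symm⟩
  · exact hφ_eq 0 h0 0 (hdec.zero_mem hu.le hv) _ rfl (by simp [hc0])
  · exact hφ_eq u hu' v hvu _ rfl rfl
  · intro x hx y hy
    obtain ⟨s, hs, hxs⟩ := hdec.cover x hx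
    obtain ⟨t, ht, hyt⟩ := hdec.cover y hy
    obtain ⟨h1, h2⟩ := hφ x s hs hxs
    obtain ⟨h3, h4⟩ := hφ y t ht hyt
    have hmem := hdec.oplus_mem s hs t ht x hxs y hyt
    have hfst : (φ x + φ y).1 = s + t := by rw [Prod.fst_add, h1, h3]
    have hsnd : s + t ≤ u → (((φ x + φ y).2 : G) : K) = (x + y) - c (s + t) := fun hst => by
      rw [Prod.snd_add, AddSubgroup.coe_add, h2, h4, hc_lex s hs t ht hst x hxs y hyt]
    unfold lexInf
    rcases lt_trichotomy (s + t) u with hlt | heq | hgt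
    · rw [if_pos (hfst.trans_lt hlt)]
      rw [min_eq_left hlt.le] at hmem
      refine hφ_eq _ ⟨add_nonneg hs.1 ht.1, hlt.le⟩ _ hmem _ hfst ?_
      rw [hsnd hlt.le, inf_eq_left.mpr (hdec.add_le_of_lt hs ht hxs hyt hlt)]
    · rw [if_neg (hfst.trans heq).not_lt, if_neg (hfst.trans heq).not_gt]
      rw [heq, min_self] at hmem
      refine hφ_eq u hu' _ hmem _ (hfst.trans heq) ?_
      change (((φ x + φ y).2 : G) : K) ⊓ (v - c u) = _
      rw [hsnd heq.le, heq, sub_eq_add_neg, sub_eq_add_neg, sub_eq_add_neg, ← inf_add]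
    · rw [if_neg (by rw [hfst]; exact hgt.not_gt), if_pos (by rw [hfst]; exact hgt)]
      rw [inf_eq_right.mpr (hdec.le_add_of_lt hs ht hxs hyt hgt)]
      exact hφ_eq u hu' v hvu _ rfl rfl
  · intro x hx
    obtain ⟨t, ht, hxt⟩ := hdec.cover x hx
    obtain ⟨h1, h2⟩ := hφ x t ht hxt
    have ht' := IsHuDecomposition.sub_index_mem ht
    have hmem := hdec.sub_mem ht hxt
    refine hφ_eq _ ht' _ hmem _ (by rw [Prod.fst_sub, h1]) ?_
    have hlex := hc_lex _ ht' t ht (sub_add_cancel u t).le _ hmem x hxt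
    rw [sub_add_cancel, sub_add_cancel] at hlex
    rw [Prod.snd_sub, AddSubgroup.coe_sub, h2]
    exact sub_eq_of_eq_add hlex
  · intro x hx
    obtain ⟨t, ht, hxt⟩ := hdec.cover x hx
    obtain ⟨h1, h2⟩ := hφ x t ht hxt
    have ht' := IsHuDecomposition.neg_add_index_mem ht
    have hmem := hdec.neg_add_mem ht hxt
    refine hφ_eq _ ht' _ hmem _ (by rw [Prod.fst_add, Prod.fst_neg, h1]) ?_
    have hlex := hc_lex t ht _ ht' (add_neg_cancel_left t u).le x hxt _ hmem
    rw [add_neg_cancel_left, add_neg_cancel_left] at hlex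
    rw [Prod.snd_add, Prod.snd_neg, AddSubgroup.coe_add, AddSubgroup.coe_neg, h2]
    exact neg_add_eq_of_eq_add hlex

end Decomposition
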